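/- (Configuration H(6,10)) Let ℓ₁, ℓ₂, ℓ₃, ℓ₄ be four distinct lines in the complex projective plane ℙ², no three of which pass through a common point, and let Z be the set of their six pairwise intersection points (which are then distinct). Let I be the radical homogeneous ideal of Z. Then α̂(I) = 2; moreover, Z is not contained in a conic, and the first differences of the initial sequence of I are periodic with period (3,1): for every k ≥ 0 one has α(I^(2k+1)) = 4k + 3 and α(I^(2k+2)) = 4k + 4. -/

import Mathlib

open scoped LinearAlgebra.Projectivization

/-- A polynomial `F` vanishes to order at least `m` at the (affine representative) point
`v`: all iterated partial derivatives of order `≤ m - 1` (i.e. of order `< m`) vanish at `v`. -/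
def VanishesToOrder (m : ℕ) (F : MvPolynomial (Fin 3) ℂ) (v : Fin 3 → ℂ) : Prop :=
  ∀ k : ℕ, k < m → ∀ d : Fin k → Fin 3,
    MvPolynomial.eval v ((List.ofFn d).foldl (fun p i => MvPolynomial.pderiv i p) F) = 0

/-- The `m`-th symbolic power of the (radical) ideal of a set `Z` of points of `ℙ²`:
all polynomials vanishing to order at least `m` at every point of `Z`. -/
def symbolicPower (Z : Set (ℙ ℂ (Fin 3 → ℂ))) (m : ℕ) : Set (MvPolynomial (Fin 3) ℂ) :=
  {F | ∀ P ∈ Z, ∀ (v : Fin 3 → ℂ) (hv : v ≠ 0),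
    Projectivization.mk ℂ v hv = P → VanishesToOrder m F v}

/-- The initial degree `α` of a set of polynomials: the least `t` such that the set contains
a nonzero homogeneous polynomial of degree `t`. -/
noncomputable def initialDegree (S : Set (MvPolynomial (Fin 3) ℂ)) : ℕ :=
  sInf {t | ∃ F ∈ S, F ≠ 0 ∧ F.IsHomogeneous t}

/-- The Waldschmidt constant `α̂(I) = inf_{m ≥ 1} α(I^(m))/m` of the radical ideal of `Z`. -/
noncomputable def waldschmidt (Z : Set (ℙ ℂ (Fin 3 → ℂ))) : ℝ :=
  ⨅ m : ℕ+, (initialDegree (symbolicPower Z (m : ℕ)) : ℝ) / ((m : ℕ) : ℝ)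

/-- A (homogeneous equation of a) line in `ℙ²`: a nonzero homogeneous polynomial of degree 1. -/
def IsLine (L : MvPolynomial (Fin 3) ℂ) : Prop := L ≠ 0 ∧ L.IsHomogeneous 1

/-- The point `x ∈ ℙ²` lies on the line (or curve) with equation `L`. -/
def MemLine (L : MvPolynomial (Fin 3) ℂ) (x : ℙ ℂ (Fin 3 → ℂ)) : Prop :=
  ∀ (v : Fin 3 → ℂ) (hv : v ≠ 0), Projectivization.mk ℂ v hv = x → MvPolynomial.eval v L = 0

/-- Three points of `ℙ²` are collinear if some line contains all of them. -/
def Collin (x y z : ℙ ℂ (Fin 3 → ℂ)) : Prop :=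
  ∃ M, IsLine M ∧ MemLine M x ∧ MemLine M y ∧ MemLine M z

/-- `Z` is contained in a conic: the zero set of a nonzero homogeneous polynomial of degree 2
(possibly degenerate). -/
def ContainedInConic (Z : Set (ℙ ℂ (Fin 3 → ℂ))) : Prop :=
  ∃ F : MvPolynomial (Fin 3) ℂ, F ≠ 0 ∧ F.IsHomogeneous 2 ∧ ∀ x ∈ Z, MemLine F x

open MvPolynomial

/-- The expansion of `F (v + T • x)` as a polynomial in `T` whose coefficients are polynomials
in the generic direction `x`. -/
noncomputable def genericExpansion (v : Fin 3 → ℂ) :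
    MvPolynomial (Fin 3) ℂ →ₐ[ℂ] Polynomial (MvPolynomial (Fin 3) ℂ) :=
  aeval fun i => Polynomial.C (C (v i)) + Polynomial.X * Polynomial.C (X i)

/-- The univariate polynomial `F (v + T • u)`. -/
noncomputable def lineRestriction (v u : Fin 3 → ℂ) :
    MvPolynomial (Fin 3) ℂ →ₐ[ℂ] Polynomial ℂ :=
  aeval fun i => Polynomial.C (v i) + Polynomial.X * Polynomial.C (u i)

section Expansion

variable {v : Fin 3 → ℂ}

theorem genericExpansion_C (a : ℂ) :
    genericExpansion v (C a) = Polynomial.C (C a) := by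
  rw [genericExpansion, aeval_C]
  rfl

theorem genericExpansion_X (i : Fin 3) : genericExpansion v (X i) =
    Polynomial.C (C (v i)) + Polynomial.X * Polynomial.C (X i) := by
  rw [genericExpansion, aeval_X]

theorem coeff_zero_genericExpansion (F : MvPolynomial (Fin 3) ℂ) :
    (genericExpansion v F).coeff 0 = C (eval v F) := by
  induction F using MvPolynomial.induction_on with
  | C a => simp
  | add p q hp hq => simp [hp, hq]
  | mul_X p i hp => simp [Polynomial.mul_coeff_zero, hp, genericExpansion_X]

theorem X_dvd_genericExpansion_iff (F : MvPolynomial (Fin 3) ℂ) :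
    Polynomial.X ∣ genericExpansion v F ↔ eval v F = 0 := by
  rw [Polynomial.X_dvd_iff, coeff_zero_genericExpansion, C_eq_zero]

theorem derivative_genericExpansion (F : MvPolynomial (Fin 3) ℂ) :
    Polynomial.derivative (genericExpansion v F) =
      ∑ i, Polynomial.C (X i) * genericExpansion v (pderiv i F) := by
  induction F using MvPolynomial.induction_on with
  | C a => simp
  | add p q hp hq => simp [hp, hq, mul_add, Finset.sum_add_distrib]
  | mul_X p n hp =>
    have h : ∀ i, Polynomial.C (X i) * genericExpansion v (pderiv i (p * X n)) =
        Polynomial.C (X i) * genericExpansion v (pderiv i p) * genericExpansion v (X n) +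
          if i = n then Polynomial.C (X i) * genericExpansion v p else 0 := by
      intro i
      rw [pderiv_mul, map_add, map_mul, map_mul]
      split_ifs with hi
      · subst hi
        rw [pderiv_X_self, map_one]
        ring
      · rw [pderiv_X_of_ne (Ne.symm hi), map_zero]
        ring
    rw [Finset.sum_congr rfl fun i _ => h i, Finset.sum_add_distrib, ← Finset.sum_mul, ← hp,
      map_mul, Polynomial.derivative_mul, genericExpansion_X,
      Finset.sum_ite_eq' Finset.univ n, if_pos (Finset.mem_univ n), map_add,
      Polynomial.derivative_mul, Polynomial.derivative_C, Polynomial.derivative_X,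
      Polynomial.derivative_C]
    ring

theorem X_pow_succ_dvd_of_derivative {R : Type*} [CommRing R] [IsDomain R] [CharZero R]
    {f : Polynomial R} {m : ℕ} (h0 : f.coeff 0 = 0)
    (h : Polynomial.X ^ m ∣ Polynomial.derivative f) : Polynomial.X ^ (m + 1) ∣ f := by
  rw [Polynomial.X_pow_dvd_iff] at h ⊢
  intro d hd
  cases d with
  | zero => exact h0
  | succ d =>
    have := h d (by omega)
    rw [Polynomial.coeff_derivative] at this
    exact (mul_eq_zero.mp this).resolve_right (by exact_mod_cast d.succ_ne_zero)

end Expansion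

section VanishingOrder

variable {v : Fin 3 → ℂ} {F G : MvPolynomial (Fin 3) ℂ} {m n : ℕ}

theorem vanishesToOrder_zero : VanishesToOrder 0 F v := fun _ hk => absurd hk (Nat.not_lt_zero _)

theorem vanishesToOrder_succ_iff :
    VanishesToOrder (m + 1) F v ↔ eval v F = 0 ∧ ∀ i, VanishesToOrder m (pderiv i F) v := by
  constructor
  · refine fun h => ⟨by simpa using h 0 (Nat.succ_pos m) Fin.elim0, fun i k hk d => ?_⟩
    simpa [List.ofFn_succ] using h (k + 1) (by omega) (Fin.cons i d)
  · rintro ⟨h0, h⟩ k hk d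
    cases k with
    | zero => simpa using h0
    | succ k =>
      rw [List.ofFn_succ, List.foldl_cons]
      exact h (d 0) k (by omega) fun j => d j.succ

theorem VanishesToOrder.mono (h : VanishesToOrder n F v) (hmn : m ≤ n) : VanishesToOrder m F v :=
  fun k hk => h k (hk.trans_le hmn)

theorem VanishesToOrder.add (hF : VanishesToOrder m F v) (hG : VanishesToOrder m G v) :
    VanishesToOrder m (F + G) v := by
  induction m generalizing F G with
  | zero => exact vanishesToOrder_zero
  | succ m ih =>
    rw [vanishesToOrder_succ_iff] at *
    refine ⟨by rw [map_add, hF.1, hG.1, add_zero], fun i => ?_⟩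
    rw [map_add]
    exact ih (hF.2 i) (hG.2 i)

theorem VanishesToOrder.mul (hF : VanishesToOrder m F v) (hG : VanishesToOrder n G v) :
    VanishesToOrder (m + n) (F * G) v := by
  obtain ⟨s, hs⟩ : ∃ s, s = m + n := ⟨_, rfl⟩
  rw [← hs]
  induction s generalizing m n F G with
  | zero => exact vanishesToOrder_zero
  | succ s ih =>
    rw [vanishesToOrder_succ_iff]
    constructor
    · rw [map_mul, mul_eq_zero]
      rcases Nat.eq_zero_or_pos m with rfl | hm
      · exact Or.inr (vanishesToOrder_succ_iff.mp (hG.mono (by omega : 0 + 1 ≤ n))).1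
      · exact Or.inl (vanishesToOrder_succ_iff.mp (hF.mono (by omega : 0 + 1 ≤ m))).1
    · intro i
      rw [pderiv_mul]
      apply VanishesToOrder.add
      · cases m with
        | zero => exact ih (m := 0) vanishesToOrder_zero (hG.mono (by omega : s ≤ n)) (by omega)
        | succ m => exact ih ((vanishesToOrder_succ_iff.mp hF).2 i) hG (by omega)
      · cases n with
        | zero => exact ih (n := 0) (hF.mono (by omega : s ≤ m)) vanishesToOrder_zero (by omega)
        | succ n => exact ih hF ((vanishesToOrder_succ_iff.mp hG).2 i) (by omega)

theorem vanishesToOrder_one (h : eval v F = 0) : VanishesToOrder 1 F v :=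
  vanishesToOrder_succ_iff.mpr ⟨h, fun _ => vanishesToOrder_zero⟩

theorem VanishesToOrder.pow (hF : VanishesToOrder m F v) (k : ℕ) :
    VanishesToOrder (m * k) (F ^ k) v := by
  induction k with
  | zero => exact vanishesToOrder_zero
  | succ k ih => exact pow_succ F k ▸ ih.mul hF

theorem VanishesToOrder.X_pow_dvd (h : VanishesToOrder m F v) :
    Polynomial.X ^ m ∣ genericExpansion v F := by
  induction m generalizing F with
  | zero => simp
  | succ m ih =>
    rw [vanishesToOrder_succ_iff] at h
    apply X_pow_succ_dvd_of_derivative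
    · rw [coeff_zero_genericExpansion, h.1, C_0]
    · rw [derivative_genericExpansion]
      exact Finset.dvd_sum fun i _ => (ih (h.2 i)).mul_left _

end VanishingOrder

section Homogeneous

variable {F G P : MvPolynomial (Fin 3) ℂ} {d e : ℕ}

theorem MvPolynomial.IsHomogeneous.eval_smul (hF : F.IsHomogeneous d) (c : ℂ) (x : Fin 3 → ℂ) :
    eval (c • x) F = c ^ d * eval x F := by
  rw [eval_eq', eval_eq', Finset.mul_sum]
  refine Finset.sum_congr rfl fun s hs => ?_
  have hd : ∑ i, s i = d := by
    rw [← Finsupp.degree_eq_sum]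
    exact (hF.degree_eq_sum_deg_support hs).symm
  simp only [Pi.smul_apply, smul_eq_mul, mul_pow, Finset.prod_mul_distrib,
    Finset.prod_pow_eq_pow_sum, hd]
  ring

theorem MvPolynomial.IsHomogeneous.exists_of_mul (hP : P.IsHomogeneous d) (hF : F.IsHomogeneous e)
    (hF0 : F ≠ 0) (h : F = P * G) : ∃ k, e = d + k ∧ G.IsHomogeneous k := by
  have hP0 : P ≠ 0 := by rintro rfl; simp [h] at hF0
  have hG0 : G ≠ 0 := by rintro rfl; simp [h] at hF0
  have hdeg : e = d + G.totalDegree := by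
    rw [← hF.totalDegree hF0, h, totalDegree_mul_of_isDomain hP0 hG0, hP.totalDegree hP0]
  refine ⟨_, hdeg, ?_⟩
  let _ := MvPolynomial.gradedAlgebra (σ := Fin 3) (R := ℂ)
  have key := DirectSum.coe_decompose_mul_add_of_left_mem (homogeneousSubmodule (Fin 3) ℂ)
    (b := G) (j := G.totalDegree) ((mem_homogeneousSubmodule d P).mpr hP)
  rw [← h, ← hdeg, DirectSum.decompose_of_mem_same _ ((mem_homogeneousSubmodule e F).mpr hF),
    h] at key
  have hmem := SetLike.coe_mem
    (DirectSum.decompose (homogeneousSubmodule (Fin 3) ℂ) G G.totalDegree)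
  rwa [← mul_left_cancel₀ hP0 key, mem_homogeneousSubmodule] at hmem

theorem MvPolynomial.IsHomogeneous.exists_eq_sum (hF : F.IsHomogeneous 1) :
    ∃ c : Fin 3 → ℂ, F = ∑ i, C (c i) * X i := by
  rw [← mem_homogeneousSubmodule, homogeneousSubmodule_one_eq_span_X,
    Submodule.mem_span_range_iff_exists_fun] at hF
  obtain ⟨c, hc⟩ := hF
  exact ⟨c, by simp [← hc, smul_eq_C_mul]⟩

theorem MvPolynomial.IsHomogeneous.eval_add (hF : F.IsHomogeneous 1) (x y : Fin 3 → ℂ) :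
    eval (x + y) F = eval x F + eval y F := by
  obtain ⟨c, rfl⟩ := hF.exists_eq_sum
  simp [mul_add, Finset.sum_add_distrib]

theorem MvPolynomial.IsHomogeneous.genericExpansion_eq (hF : F.IsHomogeneous 1) (v : Fin 3 → ℂ) :
    genericExpansion v F = Polynomial.C (C (eval v F)) + Polynomial.X * Polynomial.C F := by
  obtain ⟨c, rfl⟩ := hF.exists_eq_sum
  simp only [Fin.sum_univ_three, map_add, map_mul, genericExpansion_C, genericExpansion_X, eval_C,
    eval_X]
  ring

theorem IsLine.prime (h : IsLine F) : Prime F := by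
  rw [← irreducible_iff_prime]
  refine irreducible_of_totalDegree_eq_one (h.2.totalDegree h.1) fun x hx => ?_
  obtain ⟨s, hs⟩ := ne_zero_iff.mp h.1
  exact isUnit_iff_ne_zero.mpr fun hx0 => hs (zero_dvd_iff.mp (hx0 ▸ hx s))

theorem IsLine.dvd_of_forall_eval_eq_zero (hF : IsLine F)
    (h : ∀ x, eval x F = 0 → eval x G = 0) : F ∣ G := by
  have hp : (Ideal.span {F}).IsPrime := (Ideal.span_singleton_prime hF.1).mpr hF.prime
  rw [← Ideal.mem_span_singleton,
    ← IsPrime.vanishingIdeal_zeroLocus (K := ℂ) (Ideal.span {F})]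
  intro x hx
  have := hx F (Ideal.mem_span_singleton_self F)
  rw [aeval_eq_eval] at *
  exact h x this

/-- Dividing by a form that vanishes simply at `v` lowers the vanishing order by at most one. -/
theorem IsLine.X_pow_dvd_of_mul {v : Fin 3 → ℂ} {m : ℕ} (hF : IsLine F) (h0 : eval v F = 0)
    (h : Polynomial.X ^ (m + 1) ∣ genericExpansion v (F * G)) :
    Polynomial.X ^ m ∣ genericExpansion v G := by
  rw [map_mul, hF.2.genericExpansion_eq, h0, C_0, Polynomial.C_0, zero_add, pow_succ', mul_assoc,
    mul_dvd_mul_iff_left Polynomial.X_ne_zero] at h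
  refine Polynomial.prime_X.pow_dvd_of_dvd_mul_left m ?_ h
  simpa [Polynomial.X_dvd_iff] using hF.1

end Homogeneous

section Restriction

variable {F : MvPolynomial (Fin 3) ℂ} {d m : ℕ}

theorem eval_lineRestriction (v u : Fin 3 → ℂ) (t : ℂ) :
    (lineRestriction v u F).eval t = eval (v + t • u) F := by
  induction F using MvPolynomial.induction_on with
  | C a => simp [lineRestriction]
  | add p q hp hq => simp [hp, hq]
  | mul_X p i hp =>
    rw [map_mul, Polynomial.eval_mul, hp, map_mul]
    simp [lineRestriction, -Polynomial.X_mul_C]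

theorem map_genericExpansion (v u : Fin 3 → ℂ) :
    (genericExpansion v F).map (eval u) = lineRestriction v u F := by
  induction F using MvPolynomial.induction_on with
  | C a => simp [lineRestriction]
  | add p q hp hq => simp [hp, hq]
  | mul_X p i hp =>
    rw [map_mul, Polynomial.map_mul, hp, map_mul, genericExpansion_X]
    simp [lineRestriction]

theorem lineRestriction_comp (v u : Fin 3 → ℂ) (t : ℂ) :
    (lineRestriction (v + t • u) u F).comp (Polynomial.X - Polynomial.C t) =
      lineRestriction v u F := by
  refine Polynomial.funext fun s => ?_
  rw [Polynomial.eval_comp, eval_lineRestriction, eval_lineRestriction]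
  congr 2
  ext i
  simp
  ring

theorem X_sub_C_pow_dvd_lineRestriction {v u : Fin 3 → ℂ} {t : ℂ}
    (h : Polynomial.X ^ m ∣ genericExpansion (v + t • u) F) :
    (Polynomial.X - Polynomial.C t) ^ m ∣ lineRestriction v u F := by
  obtain ⟨q, hq⟩ := h
  have := congrArg (fun p => (p.map (eval u)).comp (Polynomial.X - Polynomial.C t)) hq
  simp only [map_genericExpansion, lineRestriction_comp] at this
  simp [this]

theorem MvPolynomial.IsHomogeneous.natDegree_lineRestriction_le (hF : F.IsHomogeneous d)
    (v u : Fin 3 → ℂ) : (lineRestriction v u F).natDegree ≤ d := by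
  have := aeval_natDegree_le (n := 1) F hF.totalDegree_le
    (fun i => Polynomial.C (v i) + Polynomial.X * Polynomial.C (u i)) fun i =>
      (Polynomial.natDegree_add_le _ _).trans (by
        rw [Polynomial.natDegree_C]
        exact max_le zero_le_one ((Polynomial.natDegree_mul_C_le _ _).trans
          Polynomial.natDegree_X_le))
  rwa [mul_one] at this

/-- A form of degree less than `3 * m` vanishing to order `m` at three points of a line vanishes
identically on that line. -/
theorem MvPolynomial.IsHomogeneous.eval_eq_zero_of_three_points (hF : F.IsHomogeneous d)
    (hd : d < 3 * m) {v w : Fin 3 → ℂ} (hv : Polynomial.X ^ m ∣ genericExpansion v F)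
    (hw : Polynomial.X ^ m ∣ genericExpansion w F)
    (hvw : Polynomial.X ^ m ∣ genericExpansion ((2 : ℂ)⁻¹ • (v + w)) F) (a b : ℂ) :
    eval (a • v + b • w) F = 0 := by
  have h0 : lineRestriction v (w - v) F = 0 := by
    have d0 := X_sub_C_pow_dvd_lineRestriction (v := v) (u := w - v) (t := 0) (by simpa using hv)
    have d1 := X_sub_C_pow_dvd_lineRestriction (v := v) (u := w - v) (t := 1) (by simpa using hw)
    have d2 := X_sub_C_pow_dvd_lineRestriction (v := v) (u := w - v) (t := 2⁻¹) (by
      have : v + (2 : ℂ)⁻¹ • (w - v) = (2 : ℂ)⁻¹ • (v + w) := by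
        ext i
        simp
        ring
      rwa [this])
    have c01 := (Polynomial.isCoprime_X_sub_C_of_isUnit_sub (a := (0 : ℂ)) (b := 1)
      (by norm_num)).pow (m := m) (n := m)
    have c02 := (Polynomial.isCoprime_X_sub_C_of_isUnit_sub (a := (0 : ℂ)) (b := 2⁻¹)
      (by norm_num)).pow (m := m) (n := m)
    have c12 := (Polynomial.isCoprime_X_sub_C_of_isUnit_sub (a := (1 : ℂ)) (b := 2⁻¹)
      (by norm_num)).pow (m := m) (n := m)
    have hdvd := (c02.mul_left c12).mul_dvd (c01.mul_dvd d0 d1) d2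
    by_contra hne
    have := Polynomial.natDegree_le_of_dvd hdvd hne
    have hle := hF.natDegree_lineRestriction_le v (w - v)
    have mon : ∀ t : ℂ, ((Polynomial.X - Polynomial.C t) ^ m).Monic := fun t =>
      (Polynomial.monic_X_sub_C t).pow m
    rw [((mon 0).mul (mon 1)).natDegree_mul (mon _), (mon 0).natDegree_mul (mon _)] at this
    simp only [Polynomial.natDegree_pow, Polynomial.natDegree_X_sub_C] at this
    omega
  have hgen : ∀ a b : ℂ, a + b ≠ 0 → eval (a • v + b • w) F = 0 := by
    intro a b hab
    have h1 : a • v + b • w = (a + b) • (v + (b / (a + b)) • (w - v)) := by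
      ext i
      simp
      field_simp
      ring
    rw [h1, hF.eval_smul, ← eval_lineRestriction, h0]
    simp
  by_cases hab : a + b = 0
  · have h2 : Polynomial.X * lineRestriction (a • v + b • w) v F = 0 := by
      refine Polynomial.funext fun t => ?_
      by_cases ht : t = 0
      · simp [ht]
      · have h3 : a • v + b • w + t • v = (a + t) • v + b • w := by
          ext i
          simp
          ring
        rw [Polynomial.eval_mul, eval_lineRestriction, h3, hgen _ _ (by
          rwa [add_right_comm, hab, zero_add])]
        simp
    have h4 := (mul_eq_zero.mp h2).resolve_left Polynomial.X_ne_zero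
    have h5 := eval_lineRestriction (F := F) (a • v + b • w) v 0
    rw [h4] at h5
    simpa using h5.symm
  · exact hgen a b hab

end Restriction

section Lines

theorem memLine_mk_iff {F : MvPolynomial (Fin 3) ℂ} {d : ℕ} (hF : F.IsHomogeneous d)
    {v : Fin 3 → ℂ} (hv : v ≠ 0) :
    MemLine F (Projectivization.mk ℂ v hv) ↔ eval v F = 0 := by
  refine ⟨fun h => h v hv rfl, fun h w hw hwv => ?_⟩
  obtain ⟨a, rfl⟩ := (Projectivization.mk_eq_mk_iff' ℂ w v hw hv).mp hwv
  rw [hF.eval_smul, h, mul_zero]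

theorem exists_ne_zero_of_two_lines {F G : MvPolynomial (Fin 3) ℂ} (hF : F.IsHomogeneous 1)
    (hG : G.IsHomogeneous 1) : ∃ x : Fin 3 → ℂ, x ≠ 0 ∧ eval x F = 0 ∧ eval x G = 0 := by
  obtain ⟨a, rfl⟩ := hF.exists_eq_sum
  obtain ⟨b, rfl⟩ := hG.exists_eq_sum
  obtain ⟨x, hx, h⟩ := Matrix.exists_mulVec_eq_zero_iff.mpr
    (Matrix.det_zero_of_row_eq (M := Matrix.of ![a, b, b]) (i := 1) (j := 2) (by decide) rfl)
  refine ⟨x, hx, ?_, ?_⟩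
  · simpa [Matrix.mulVec, dotProduct] using congrFun h 0
  · simpa [Matrix.mulVec, dotProduct] using congrFun h 1

theorem exists_fin_four_ne_ne : ∀ i j : Fin 4, ∃ k, i ≠ k ∧ j ≠ k := by decide

/-- No three of the lines `L i` have a common point. -/
def NoThreeConcurrent (L : Fin 4 → MvPolynomial (Fin 3) ℂ) : Prop :=
  ∀ i j k, i ≠ j → i ≠ k → j ≠ k → ∀ x, eval x (L i) = 0 → eval x (L j) = 0 →
    eval x (L k) = 0 → x = 0

variable {L : Fin 4 → MvPolynomial (Fin 3) ℂ} {F : MvPolynomial (Fin 3) ℂ} {d m : ℕ}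

theorem NoThreeConcurrent.dvd (hL : ∀ i, IsLine (L i)) (hind : NoThreeConcurrent L)
    (hF : F.IsHomogeneous d) (hd : d < 3 * m)
    (h : ∀ i j, i ≠ j → ∀ x, x ≠ 0 → eval x (L i) = 0 → eval x (L j) = 0 →
      Polynomial.X ^ m ∣ genericExpansion x F) (i : Fin 4) : L i ∣ F := by
  obtain ⟨j, k, l, hij, hik, hil, hjk, hjl, hkl⟩ : ∃ j k l : Fin 4,
      i ≠ j ∧ i ≠ k ∧ i ≠ l ∧ j ≠ k ∧ j ≠ l ∧ k ≠ l := by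
    revert i
    decide
  obtain ⟨x, hx, hxi, hxj⟩ := exists_ne_zero_of_two_lines (hL i).2 (hL j).2
  obtain ⟨y, hy, hyi, hyk⟩ := exists_ne_zero_of_two_lines (hL i).2 (hL k).2
  have hxk : eval x (L k) ≠ 0 := fun h0 => hx (hind i j k hij hik hjk x hxi hxj h0)
  have hxl : eval x (L l) ≠ 0 := fun h0 => hx (hind i j l hij hil hjl x hxi hxj h0)
  have hyj : eval y (L j) ≠ 0 := fun h0 => hy (hind i j k hij hik hjk y hyi h0 hyk)
  have hyl : eval y (L l) ≠ 0 := fun h0 => hy (hind i k l hik hil hkl y hyi hyk h0)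
  have hlin : ∀ n (a b : ℂ), eval (a • x + b • y) (L n) = a * eval x (L n) + b * eval y (L n) := by
    intro n a b
    rw [(hL n).2.eval_add, (hL n).2.eval_smul, (hL n).2.eval_smul, pow_one, pow_one]
  apply (hL i).dvd_of_forall_eval_eq_zero
  intro q hq
  have hcomb : q = (eval q (L k) / eval x (L k)) • x + (eval q (L j) / eval y (L j)) • y := by
    rw [← sub_eq_zero, sub_eq_add_neg, ← neg_one_smul ℂ]
    refine hind i j k hij hik hjk _ ?_ ?_ ?_ <;>
      rw [(hL _).2.eval_add, (hL _).2.eval_smul, hlin]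
    · simp [hq, hxi, hyi]
    · simp [hxj, hyj]
    · simp [hyk, hxk]
  set v := eval y (L l) • x with hv
  set w := (-eval x (L l)) • y with hw
  have hvw : ∀ n, eval (v + w) (L n) =
      eval y (L l) * eval x (L n) + -eval x (L l) * eval y (L n) := fun n => hlin n _ _
  have hvwk : eval (v + w) (L k) ≠ 0 := by
    rw [hvw, hyk, mul_zero, add_zero]
    exact mul_ne_zero hyl hxk
  have hvw0 : v + w ≠ 0 := by
    intro h0
    rw [h0] at hvwk
    exact hvwk (by simpa using (hL k).2.eval_smul 0 0)
  have hzero := hF.eval_eq_zero_of_three_points hd (v := v) (w := w)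
    (h i j hij v (smul_ne_zero hyl hx) (by rw [(hL i).2.eval_smul, hxi, mul_zero])
      (by rw [(hL j).2.eval_smul, hxj, mul_zero]))
    (h i k hik w (smul_ne_zero (neg_ne_zero.mpr hxl) hy)
      (by rw [(hL i).2.eval_smul, hyi, mul_zero]) (by rw [(hL k).2.eval_smul, hyk, mul_zero]))
    (h i l hil _ (smul_ne_zero (by norm_num) hvw0)
      (by rw [(hL i).2.eval_smul, hvw, hxi, hyi]; ring)
      (by rw [(hL l).2.eval_smul, hvw]; ring))
    (eval q (L k) / eval x (L k) / eval y (L l)) (eval q (L j) / eval y (L j) / -eval x (L l))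
  rw [hv, hw, smul_smul, smul_smul, div_mul_cancel₀ _ hyl,
    div_mul_cancel₀ _ (neg_ne_zero.mpr hxl), ← hcomb] at hzero
  exact hzero

theorem NoThreeConcurrent.prod_dvd (hL : ∀ i, IsLine (L i)) (hind : NoThreeConcurrent L)
    (h : ∀ i, L i ∣ F) : ∏ i, L i ∣ F := by
  refine Finset.prod_dvd_of_isRelPrime (fun i _ j _ hij => ?_) fun i _ => h i
  refine (hL i).prime.irreducible.isRelPrime_iff_not_dvd.mpr fun hdvd => ?_
  obtain ⟨k, hik, hjk⟩ := exists_fin_four_ne_ne i j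
  obtain ⟨x, hx, hxi, hxk⟩ := exists_ne_zero_of_two_lines (hL i).2 (hL k).2
  refine hx (hind i j k hij hik hjk x hxi ?_ hxk)
  obtain ⟨q, hq⟩ := hdvd
  rw [hq, map_mul, hxi, zero_mul]

/-- A nonzero form vanishing to order `m` at the six intersection points has degree at least
`2 * m`, and at least `2 * m + 1` when `m` is odd. -/
theorem NoThreeConcurrent.le_degree (hL : ∀ i, IsLine (L i)) (hind : NoThreeConcurrent L)
    (hF : F.IsHomogeneous d) (hF0 : F ≠ 0)
    (h : ∀ i j, i ≠ j → ∀ x, x ≠ 0 → eval x (L i) = 0 → eval x (L j) = 0 →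
      Polynomial.X ^ m ∣ genericExpansion x F) : 2 * m + m % 2 ≤ d := by
  induction m using Nat.strong_induction_on generalizing F d with
  | _ m ih =>
    by_contra hlt
    obtain ⟨G, hG⟩ := hind.prod_dvd hL (hind.dvd hL hF (by omega) h)
    have hprod : (∏ i, L i).IsHomogeneous 4 := by
      simpa using IsHomogeneous.prod Finset.univ L (fun _ => 1) fun i _ => (hL i).2
    obtain ⟨k, rfl, hk⟩ := hprod.exists_of_mul hF hF0 hG
    obtain ⟨n, rfl⟩ : ∃ n, m = n + 1 + 1 := ⟨m - 2, by omega⟩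
    have hG0 : G ≠ 0 := by rintro rfl; simp [hG] at hF0
    have := ih n (by omega) hk hG0 fun i j hij x hx hxi hxj => by
      have hdvd := h i j hij x hx hxi hxj
      rw [hG, ← Finset.mul_prod_erase _ _ (Finset.mem_univ i),
        ← Finset.mul_prod_erase _ _ (Finset.mem_erase.mpr ⟨hij.symm, Finset.mem_univ j⟩),
        mul_assoc, mul_assoc] at hdvd
      have h2 := (hL j).X_pow_dvd_of_mul hxj ((hL i).X_pow_dvd_of_mul hxi hdvd)
      rw [map_mul] at h2
      refine Polynomial.prime_X.pow_dvd_of_dvd_mul_left n ?_ h2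
      rw [X_dvd_genericExpansion_iff, map_prod, Finset.prod_eq_zero_iff]
      rintro ⟨l, hl, hxl⟩
      simp only [Finset.mem_erase] at hl
      exact hx (hind i j l hij (Ne.symm hl.2.1) (Ne.symm hl.1) x hxi hxj hxl)
    omega

theorem NoThreeConcurrent.ncard_eq_six (hL : ∀ i, IsLine (L i)) (hind : NoThreeConcurrent L) :
    {x | ∃ i j, i ≠ j ∧ MemLine (L i) x ∧ MemLine (L j) x}.ncard = 6 := by
  choose p hp0 hp1 hp2 using fun i j => exists_ne_zero_of_two_lines (hL i).2 (hL j).2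
  let s : Finset (Fin 4 × Fin 4) := Finset.univ.filter fun a => a.1 < a.2
  have himage : {x | ∃ i j, i ≠ j ∧ MemLine (L i) x ∧ MemLine (L j) x} =
      (fun a : Fin 4 × Fin 4 => Projectivization.mk ℂ (p a.1 a.2) (hp0 a.1 a.2)) '' s := by
    ext x
    constructor
    · rintro ⟨i, j, hij, hi, hj⟩
      wlog hlt : i < j generalizing i j
      · exact this j i hij.symm hj hi (lt_of_le_of_ne (not_lt.mp hlt) hij.symm)
      refine ⟨(i, j), by simpa [s] using hlt, ?_⟩
      induction x using Projectivization.ind with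
      | h v hv =>
        rw [memLine_mk_iff (hL _).2] at hi hj
        rw [Projectivization.mk_eq_mk_iff']
        obtain ⟨k, hik, hjk⟩ := exists_fin_four_ne_ne i j
        have hk : eval v (L k) ≠ 0 := fun h0 => hv (hind i j k hij hik hjk v hi hj h0)
        refine ⟨eval (p i j) (L k) / eval v (L k), ?_⟩
        rw [← sub_eq_zero, sub_eq_add_neg, ← neg_one_smul ℂ (p i j)]
        refine hind i j k hij hik hjk _ ?_ ?_ ?_ <;>
          rw [(hL _).2.eval_add, (hL _).2.eval_smul, (hL _).2.eval_smul]
        · simp [hi, hp1]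
        · simp [hj, hp2]
        · simp [hk]
    · rintro ⟨⟨i, j⟩, hlt, rfl⟩
      refine ⟨i, j, ?_, (memLine_mk_iff (hL i).2 _).mpr (hp1 i j),
        (memLine_mk_iff (hL j).2 _).mpr (hp2 i j)⟩
      simp only [s, Finset.coe_filter, Finset.mem_univ, true_and, Set.mem_ofPred_eq] at hlt
      exact hlt.ne
  rw [himage, Set.InjOn.ncard_image, Set.ncard_coe_finset]
  · decide
  · rintro ⟨i, j⟩ hij ⟨k, l⟩ hkl heq
    simp only [s, Finset.coe_filter, Finset.mem_univ, true_and, Set.mem_ofPred_eq] at hij hkl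
    obtain ⟨a, ha⟩ := (Projectivization.mk_eq_mk_iff' ℂ _ _ _ _).mp heq
    have hk : eval (p i j) (L k) = 0 := by rw [← ha, (hL k).2.eval_smul, hp1, mul_zero]
    have hl : eval (p i j) (L l) = 0 := by rw [← ha, (hL l).2.eval_smul, hp2, mul_zero]
    have hk' : k = i ∨ k = j := by
      by_contra! hne
      exact hp0 i j (hind i j k hij.ne hne.1.symm hne.2.symm _ (hp1 i j) (hp2 i j) hk)
    have hl' : l = i ∨ l = j := by
      by_contra! hne
      exact hp0 i j (hind i j l hij.ne hne.1.symm hne.2.symm _ (hp1 i j) (hp2 i j) hl)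
    rw [Prod.mk.injEq]
    omega

end Lines

theorem initialDegree_eq {S : Set (MvPolynomial (Fin 3) ℂ)} {t : ℕ}
    (hmem : ∃ F ∈ S, F ≠ 0 ∧ F.IsHomogeneous t)
    (hle : ∀ F ∈ S, F ≠ 0 → ∀ d, F.IsHomogeneous d → t ≤ d) : initialDegree S = t :=
  le_antisymm (Nat.sInf_le hmem)
    (le_csInf ⟨t, hmem⟩ fun d ⟨F, hF, hF0, hFd⟩ => hle F hF hF0 d hFd)

/-- Configuration `H(6,10)`: if `Z` is the set of the six pairwise intersection points of four
distinct lines in `ℙ²`, no three of which are concurrent, then the six points are distinct,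
`α̂(I) = 2`, `Z` is not contained in a conic, and the first differences of the initial sequence
of `I` are periodic with period `(3,1)`: `α(I^(2k+1)) = 4k + 3` and `α(I^(2k+2)) = 4k + 4`. -/
theorem H6_10 (L : Fin 4 → MvPolynomial (Fin 3) ℂ) (hL : ∀ i, IsLine (L i))
    (hdist : ∀ i j, i ≠ j → {x | MemLine (L i) x} ≠ {x | MemLine (L j) x})
    (hconc : ∀ i j k, i ≠ j → i ≠ k → j ≠ k →
      ¬ ∃ x : ℙ ℂ (Fin 3 → ℂ), MemLine (L i) x ∧ MemLine (L j) x ∧ MemLine (L k) x)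
    (Z : Set (ℙ ℂ (Fin 3 → ℂ)))
    (hZ : Z = {x | ∃ i j, i ≠ j ∧ MemLine (L i) x ∧ MemLine (L j) x}) :
    Z.ncard = 6 ∧ waldschmidt Z = 2 ∧ ¬ ContainedInConic Z ∧
      ∀ k : ℕ,
        initialDegree (symbolicPower Z (2 * k + 1)) = 4 * k + 3 ∧
        initialDegree (symbolicPower Z (2 * k + 2)) = 4 * k + 4 := by
  have hind : NoThreeConcurrent L := by
    intro i j k hij hik hjk x hi hj hk
    by_contra hx
    exact hconc i j k hij hik hjk ⟨Projectivization.mk ℂ x hx,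
      (memLine_mk_iff (hL i).2 hx).mpr hi, (memLine_mk_iff (hL j).2 hx).mpr hj,
      (memLine_mk_iff (hL k).2 hx).mpr hk⟩
  have hlower : ∀ m, ∀ F ∈ symbolicPower Z m, F ≠ 0 → ∀ d, F.IsHomogeneous d →
      2 * m + m % 2 ≤ d := by
    intro m F hFm hF0 d hFd
    refine hind.le_degree hL hFd hF0 fun i j hij x hx hi hj => ?_
    refine (hFm (Projectivization.mk ℂ x hx) ?_ x hx rfl).X_pow_dvd
    rw [hZ]
    exact ⟨i, j, hij, (memLine_mk_iff (hL i).2 hx).mpr hi, (memLine_mk_iff (hL j).2 hx).mpr hj⟩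
  have hprod_ne : ∀ s : Finset (Fin 4), ∏ i ∈ s, L i ≠ 0 := fun s =>
    Finset.prod_ne_zero_iff.mpr fun i _ => (hL i).1
  have hprod_hom : ∀ s : Finset (Fin 4), (∏ i ∈ s, L i).IsHomogeneous s.card := fun s => by
    simpa using IsHomogeneous.prod s L (fun _ => 1) fun i _ => (hL i).2
  have hprod_two : ∀ i j, i ≠ j → ∀ x, eval x (L i) = 0 → eval x (L j) = 0 →
      VanishesToOrder 2 (∏ i, L i) x := by
    intro i j hij x hi hj
    rw [← Finset.mul_prod_erase _ _ (Finset.mem_univ i),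
      ← Finset.mul_prod_erase _ _ (Finset.mem_erase.mpr ⟨hij.symm, Finset.mem_univ j⟩)]
    exact (vanishesToOrder_one hi).mul ((vanishesToOrder_one hj).mul
      (vanishesToOrder_zero (F := ∏ k ∈ (Finset.univ.erase i).erase j, L k)))
  have hprod_one : ∀ i j, i ≠ j → ∀ x, eval x (L i) = 0 → eval x (L j) = 0 →
      VanishesToOrder 1 (∏ i ∈ Finset.univ.erase 3, L i) x := by
    intro i j hij x hi hj
    apply vanishesToOrder_one
    rw [map_prod, Finset.prod_eq_zero_iff]
    by_cases h3 : i = 3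
    · exact ⟨j, Finset.mem_erase.mpr ⟨fun h => hij (h3.trans h.symm), Finset.mem_univ j⟩, hj⟩
    · exact ⟨i, Finset.mem_erase.mpr ⟨h3, Finset.mem_univ i⟩, hi⟩
  have hseq : ∀ k : ℕ, initialDegree (symbolicPower Z (2 * k + 1)) = 4 * k + 3 ∧
      initialDegree (symbolicPower Z (2 * k + 2)) = 4 * k + 4 := by
    intro k
    constructor
    · refine initialDegree_eq ⟨(∏ i, L i) ^ k * ∏ i ∈ Finset.univ.erase 3, L i, ?_,
        mul_ne_zero (pow_ne_zero k (hprod_ne _)) (hprod_ne _),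
        ((hprod_hom Finset.univ).pow k).mul (hprod_hom (Finset.univ.erase 3))⟩ ?_
      · intro P hP v hv hvP
        rw [hZ, ← hvP] at hP
        obtain ⟨i, j, hij, hi, hj⟩ := hP
        rw [memLine_mk_iff (hL _).2] at hi hj
        exact ((hprod_two i j hij v hi hj).pow k).mul (hprod_one i j hij v hi hj)
      · intro F hF hF0 d hd
        have := hlower _ F hF hF0 d hd
        omega
    · refine initialDegree_eq ⟨(∏ i, L i) ^ (k + 1), ?_, pow_ne_zero _ (hprod_ne _),
        (hprod_hom Finset.univ).pow (k + 1)⟩ ?_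
      · intro P hP v hv hvP
        rw [hZ, ← hvP] at hP
        obtain ⟨i, j, hij, hi, hj⟩ := hP
        rw [memLine_mk_iff (hL _).2] at hi hj
        exact (hprod_two i j hij v hi hj).pow (k + 1)
      · intro F hF hF0 d hd
        have := hlower _ F hF hF0 d hd
        omega
  refine ⟨hZ ▸ hind.ncard_eq_six hL, ?_, ?_, hseq⟩
  · have hbound : ∀ m : ℕ+,
        (2 : ℝ) ≤ (initialDegree (symbolicPower Z (m : ℕ)) : ℝ) / ((m : ℕ) : ℝ) := by
      intro m
      have hle : 2 * (m : ℕ) ≤ initialDegree (symbolicPower Z (m : ℕ)) := by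
        have hpos := m.pos
        obtain ⟨k, hk | hk⟩ : ∃ k, (m : ℕ) = 2 * k + 1 ∨ (m : ℕ) = 2 * k + 2 :=
          ⟨((m : ℕ) - 1) / 2, by omega⟩
        · rw [hk, (hseq k).1]
          omega
        · rw [hk, (hseq k).2]
          omega
      rw [le_div_iff₀ (by exact_mod_cast m.pos)]
      exact_mod_cast hle
    refine le_antisymm ((ciInf_le ⟨2, Set.forall_mem_range.mpr hbound⟩ 2).trans ?_)
      (le_ciInf hbound)
    have h4 : initialDegree (symbolicPower Z ((2 : ℕ+) : ℕ)) = 4 := (hseq 0).2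
    rw [h4]
    norm_num
  · rintro ⟨F, hF0, hF, hFZ⟩
    have := hlower 1 F (fun P hP v hv hvP => vanishesToOrder_one (hFZ P hP v hv hvP)) hF0 2 hF
    omega
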